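/- Let N ≥ 2, n ≥ 2, and let χ⁽¹⁾,…,χ⁽ⁿ⁾ be the vanishing-order sequences of n nonzero partitions of N. Let χ be the nodal sequence χ_k := max(1, ∑_{i=1}^{n} χ⁽ⁱ⁾_k − (n−1)k), let m₁ and m₂ be the multiplicities of 1 and 2 in χ, and let b^C := #{k ∈ {2,…,N} : ∑_{i=1}^{n} χ⁽ⁱ⁾_k ≤ (n−1)k} be the number of center parameters. Then m₁ − 2 ≤ 2·b^C ≤ 2·(m₁ − m₂ − 1). -/

import Mathlib

/-- `p` (with parts indexed from 1) is a partition of `N`: the parts are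
nonincreasing, sum to `N`, and vanish beyond index `N`. -/
def IsPartitionOf (N : ℕ) (p : ℕ → ℕ) : Prop :=
  (∀ i, 1 ≤ i → p (i + 1) ≤ p i) ∧
  (∑ j ∈ Finset.Icc 1 N, p j = N) ∧
  (∀ i, N < i → p i = 0)

/-- The vanishing order at `k` of the partition `p`: the least positive
integer `i` such that `p 1 + ⋯ + p i ≥ k`. -/
noncomputable def chiOf (p : ℕ → ℕ) (k : ℕ) : ℕ :=
  sInf {i | 1 ≤ i ∧ k ≤ ∑ j ∈ Finset.Icc 1 i, p j}

/-- `χ` is the vanishing-order sequence, on `{1,…,N}`, of the partition `p` of `N`. -/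
def IsVanishingOrderSeq (N : ℕ) (p : ℕ → ℕ) (χ : ℕ → ℕ) : Prop :=
  IsPartitionOf N p ∧ ∀ k, 1 ≤ k → k ≤ N → χ k = chiOf p k

/-- Partial sums of a partition. -/
def psum (p : ℕ → ℕ) (m : ℕ) : ℕ := ∑ j ∈ Finset.Icc 1 m, p j

lemma psum_zero (p : ℕ → ℕ) : psum p 0 = 0 := by simp [psum]

lemma psum_succ (p : ℕ → ℕ) (m : ℕ) : psum p (m + 1) = psum p m + p (m + 1) := by
  unfold psum
  rw [Finset.sum_Icc_succ_top (by omega)]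

lemma psum_mono (p : ℕ → ℕ) : Monotone (psum p) :=
  monotone_nat_of_le_succ (fun m => by rw [psum_succ]; omega)

lemma part_anti {N : ℕ} {p : ℕ → ℕ} (h : IsPartitionOf N p) {a b : ℕ} (ha : 1 ≤ a)
    (hab : a ≤ b) : p b ≤ p a := by
  induction b, hab using Nat.le_induction with
  | base => exact le_rfl
  | succ m hm ih => exact (h.1 m (by omega)).trans ih

lemma psum_le {N : ℕ} {p : ℕ → ℕ} (h : IsPartitionOf N p) (m : ℕ) : psum p m ≤ N := by
  have hN : psum p N = N := h.2.1
  rcases le_total m N with hm | hm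
  · exact (psum_mono p hm).trans hN.le
  · induction m, hm using Nat.le_induction with
    | base => exact hN.le
    | succ m hm ih => rw [psum_succ, h.2.2 (m + 1) (by omega)]; simpa using ih

lemma part_pos {N : ℕ} {p : ℕ → ℕ} (h : IsPartitionOf N p) {m : ℕ} (hm : psum p m < N) :
    1 ≤ p (m + 1) := by
  by_contra h0
  have hN : psum p N = N := h.2.1
  have key : ∀ b, m ≤ b → psum p b = psum p m := by
    intro b hb
    induction b, hb using Nat.le_induction with
    | base => rfl
    | succ b hb ih =>
      have := part_anti h (a := m + 1) (b := b + 1) (by omega) (by omega)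
      rw [psum_succ, ih]; omega
  rcases le_total m N with h1 | h1
  · have := key N h1; omega
  · have := psum_mono p h1; omega

lemma two_mul_le_psum {N : ℕ} {p : ℕ → ℕ} (h : IsPartitionOf N p) {c : ℕ} (hc : 2 ≤ p c)
    {m : ℕ} (hm : m ≤ c) : 2 * m ≤ psum p m := by
  induction m with
  | zero => simp
  | succ m ih =>
    have := ih (by omega)
    have := part_anti h (a := m + 1) (b := c) (by omega) (by omega)
    rw [psum_succ]; omega

section chi
variable {N : ℕ} {p χ : ℕ → ℕ}

lemma chi_spec (h : IsVanishingOrderSeq N p χ) {k : ℕ} (h1 : 1 ≤ k) (h2 : k ≤ N) :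
    1 ≤ χ k ∧ psum p (χ k - 1) < k ∧ k ≤ psum p (χ k) := by
  have hN : psum p N = N := h.1.2.1
  have hne : {i | 1 ≤ i ∧ k ≤ ∑ j ∈ Finset.Icc 1 i, p j}.Nonempty :=
    ⟨N, by omega, by change k ≤ psum p N; omega⟩
  have hm := Nat.sInf_mem hne
  rw [h.2 k h1 h2]
  refine ⟨hm.1, ?_, hm.2⟩
  by_contra hc
  push Not at hc
  by_cases h0 : chiOf p k - 1 = 0
  · rw [h0, psum_zero] at hc; omega
  · have : chiOf p k ≤ chiOf p k - 1 := Nat.sInf_le ⟨by omega, hc⟩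
    omega

lemma chi_le_iff (h : IsVanishingOrderSeq N p χ) {k : ℕ} (h1 : 1 ≤ k) (h2 : k ≤ N) (m : ℕ) :
    χ k ≤ m ↔ k ≤ psum p m := by
  obtain ⟨a, b, c⟩ := chi_spec h h1 h2
  constructor
  · intro hm; exact c.trans (psum_mono p hm)
  · intro hm
    by_contra hc
    have := psum_mono p (show m ≤ χ k - 1 by omega)
    omega

lemma chi_step (h : IsVanishingOrderSeq N p χ) {k : ℕ} (h1 : 1 ≤ k) (h2 : k + 1 ≤ N) :
    χ k ≤ χ (k + 1) ∧ χ (k + 1) ≤ χ k + 1 := by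
  constructor
  · rw [chi_le_iff h h1 (by omega)]
    have := (chi_spec h (k := k + 1) (by omega) h2).2.2
    omega
  · rw [chi_le_iff h (by omega) h2, psum_succ]
    have h3 := (chi_spec h h1 (by omega)).2.2
    by_cases h4 : psum p (χ k) < N
    · have := part_pos h.1 h4; omega
    · omega

lemma chi_one (h : IsVanishingOrderSeq N p χ) (h2 : 1 ≤ N) (hp : 2 ≤ p 1) : χ 1 = 1 := by
  have := (chi_spec h le_rfl h2).1
  have := (chi_le_iff h le_rfl h2 1).2 (by rw [psum_succ, psum_zero]; simp; omega)
  omega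

lemma chi_le_self (h : IsVanishingOrderSeq N p χ) (hp : 2 ≤ p 1) {k : ℕ} (h1 : 1 ≤ k)
    (h2 : k ≤ N) : χ k ≤ k := by
  induction k, h1 using Nat.le_induction with
  | base => rw [chi_one h h2 hp]
  | succ k hk ih =>
    have := ih (by omega)
    have := (chi_step h hk h2).2
    omega

lemma big_bound (h : IsVanishingOrderSeq N p χ) {k : ℕ} (h1 : 1 ≤ k) (h2 : k ≤ N)
    (hb : 2 ≤ p (χ k)) : 2 * χ k ≤ k + 1 := by
  have h3 := chi_spec h h1 h2
  have := two_mul_le_psum h.1 hb (m := χ k - 1) (by omega)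
  omega

lemma big_end (h : IsVanishingOrderSeq N p χ) {k : ℕ} (h1 : 1 ≤ k) (h2 : k + 1 ≤ N)
    (hb : 2 ≤ p (χ k)) (hs : χ (k + 1) ≠ χ k) : 2 * χ k ≤ k := by
  have h3 := chi_step h h1 h2
  have h4 := chi_le_iff h (k := k + 1) (by omega) h2 (χ k)
  have := two_mul_le_psum h.1 hb (m := χ k) (by omega)
  omega

lemma small_step (h : IsVanishingOrderSeq N p χ) {k : ℕ} (h1 : 1 ≤ k) (h2 : k + 1 ≤ N)
    (hb : p (χ k) ≤ 1) : χ (k + 1) = χ k + 1 := by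
  have h3 := chi_step h h1 h2
  have h4 := chi_le_iff h (k := k + 1) (by omega) h2 (χ k)
  have h5 := chi_spec h h1 (by omega)
  have h6 := psum_succ p (χ k - 1)
  rw [Nat.sub_add_cancel h5.1] at h6
  omega

lemma small_next (h : IsVanishingOrderSeq N p χ) {k : ℕ} (h1 : 1 ≤ k) (h2 : k + 1 ≤ N)
    (hb : p (χ k) ≤ 1) : p (χ (k + 1)) ≤ 1 :=
  (part_anti h.1 (chi_spec h h1 (by omega)).1 (chi_step h h1 h2).1).trans hb

end chi

/-- Pairing argument: below `M`, the value one occurs only at odd places. -/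
lemma pair_count (S : ℕ → ℤ) (M : ℕ)
    (hb : ∀ k, 1 ≤ k → k ≤ M → S k ≤ 1 ∧ (k % 2 = 0 → S k ≤ 0)) :
    ((Finset.Icc 1 M).filter (fun k => S k = 1)).card ≤
      ((Finset.Icc 1 M).filter (fun k => S k ≤ 0)).card + 1 := by
  have h1 := Finset.pred_card_le_card_erase
    (s := (Finset.Icc 1 M).filter (fun k => S k = 1)) (a := 1)
  have h2 : (((Finset.Icc 1 M).filter (fun k => S k = 1)).erase 1).card ≤
      ((Finset.Icc 1 M).filter (fun k => S k ≤ 0)).card := by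
    apply Finset.card_le_card_of_injOn (fun k => k - 1)
    · intro k hk
      simp only [Finset.coe_erase, Finset.coe_filter, Finset.mem_Icc, Set.mem_sdiff,
        Set.mem_ofPred_eq, Set.mem_singleton_iff] at hk ⊢
      obtain ⟨⟨⟨a, b⟩, c⟩, d⟩ := hk
      have e := (hb k a b).2
      exact ⟨by omega, (hb (k - 1) (by omega) (by omega)).2 (by omega)⟩
    · intro x hx y hy hxy
      simp only [Finset.coe_erase, Finset.coe_filter, Finset.mem_Icc, Set.mem_sdiff,
        Set.mem_ofPred_eq, Set.mem_singleton_iff] at hx hy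
      have hxy' : x - 1 = y - 1 := hxy
      omega
  omega

/-- Final counting. Either all of `[1,N]` is in the first phase, or the second phase starts at
`w`, where from there the ones fill `[w, w + L)`, the twos at most the next run. -/
lemma count_main (S : ℕ → ℤ) (N u w L L' : ℕ) (hu : 1 ≤ u) (huw : u < w) (hL : L ≤ w - u)
    (hL' : L' ≤ L) (hN : w + L ≤ N + 1)
    (hS1 : S 1 = 1)
    (hb : ∀ k, 1 ≤ k → k < w → S k ≤ 1 ∧ (k % 2 = 0 → S k ≤ 0))
    (hz : ∀ k, u < k → k < w → S k ≤ 0)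
    (h1 : ∀ k, w ≤ k → k ≤ N → (S k = 1 ↔ k < w + L))
    (h2 : ∀ k, w ≤ k → k ≤ N → S k = 2 → w + L ≤ k ∧ k < w + L + L') :
    ((Finset.Icc 1 N).filter (fun k => S k = 1)).card ≤
      ((Finset.Icc 1 N).filter (fun k => S k ≤ 0)).card + 2 ∧
    ((Finset.Icc 1 N).filter (fun k => S k = 2)).card + 1 ≤
      ((Finset.Icc 1 N).filter (fun k => S k = 1)).card := by
  constructor
  · have hp := pair_count S u (fun k a b => hb k a (by omega))
    have ha : ((Finset.Icc 1 N).filter (fun k => S k = 1)) ⊆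
        ((Finset.Icc 1 u).filter (fun k => S k = 1)) ∪ Finset.Ico w (w + L) := by
      intro k hk
      simp only [Finset.mem_union, Finset.mem_filter, Finset.mem_Icc, Finset.mem_Ico] at hk ⊢
      by_cases hkw : w ≤ k
      · right; exact ⟨hkw, (h1 k hkw (by omega)).1 hk.2⟩
      · left
        have := hz k
        exact ⟨⟨hk.1.1, by by_contra hc; have := this (by omega) (by omega); omega⟩, hk.2⟩
    have hc : ((Finset.Icc 1 u).filter (fun k => S k ≤ 0)) ∪ Finset.Ioo u w ⊆
        ((Finset.Icc 1 N).filter (fun k => S k ≤ 0)) := by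
      intro k hk
      simp only [Finset.mem_union, Finset.mem_filter, Finset.mem_Icc, Finset.mem_Ioo] at hk ⊢
      rcases hk with hk | hk
      · exact ⟨by omega, hk.2⟩
      · exact ⟨by omega, hz k hk.1 hk.2⟩
    have hd : Disjoint ((Finset.Icc 1 u).filter (fun k => S k ≤ 0)) (Finset.Ioo u w) := by
      rw [Finset.disjoint_left]
      intro k hk hk'
      simp only [Finset.mem_filter, Finset.mem_Icc, Finset.mem_Ioo] at hk hk'
      omega
    have ha' := (Finset.card_le_card ha).trans (Finset.card_union_le _ _)
    have hc' := Finset.card_le_card hc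
    rw [Finset.card_union_of_disjoint hd] at hc'
    simp only [Nat.card_Ico, Nat.card_Ioo] at ha' hc'
    omega
  · have ha : ((Finset.Icc 1 N).filter (fun k => S k = 2)) ⊆
        Finset.Ico (w + L) (w + L + L') := by
      intro k hk
      simp only [Finset.mem_filter, Finset.mem_Icc, Finset.mem_Ico] at hk ⊢
      by_cases hkw : w ≤ k
      · exact h2 k hkw (by omega) hk.2
      · have := hb k (by omega) (by omega); omega
    have hc : insert 1 (Finset.Ico w (w + L)) ⊆
        ((Finset.Icc 1 N).filter (fun k => S k = 1)) := by
      intro k hk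
      simp only [Finset.mem_insert, Finset.mem_filter, Finset.mem_Icc, Finset.mem_Ico] at hk ⊢
      rcases hk with hk | hk
      · subst hk; exact ⟨by omega, hS1⟩
      · exact ⟨by omega, (h1 k hk.1 (by omega)).2 hk.2⟩
    have ha' := Finset.card_le_card ha
    have hc' := Finset.card_le_card hc
    rw [Finset.card_insert_of_notMem (by simp; omega)] at hc'
    simp only [Nat.card_Ico] at ha' hc'
    omega

/-- The untruncated nodal sequence. -/
def nodalS {n : ℕ} (χ : Fin n → ℕ → ℕ) (k : ℕ) : ℤ :=
  (∑ i, (χ i k : ℤ)) - ((n : ℤ) - 1) * (k : ℤ)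

lemma nodalS_eq {n : ℕ} (χ : Fin n → ℕ → ℕ) (k : ℕ) :
    nodalS χ k = k - ∑ i, ((k : ℤ) - χ i k) := by
  simp [nodalS, Finset.sum_sub_distrib]; ring

lemma nodalS_step {n : ℕ} (χ : Fin n → ℕ → ℕ) (k : ℕ) :
    nodalS χ (k + 1) = nodalS χ k + 1 - ∑ i, (1 + (χ i k : ℤ) - χ i (k + 1)) := by
  simp [nodalS, Finset.sum_sub_distrib, Finset.sum_add_distrib]; ring

lemma core {N n : ℕ} (hN : 2 ≤ N) (hn : 2 ≤ n) (p χ : Fin n → ℕ → ℕ)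
    (h : ∀ i, IsVanishingOrderSeq N (p i) (χ i)) (hp : ∀ i, 2 ≤ p i 1) :
    nodalS χ 1 = 1 ∧
    ((Finset.Icc 1 N).filter (fun k => nodalS χ k = 1)).card ≤
      ((Finset.Icc 1 N).filter (fun k => nodalS χ k ≤ 0)).card + 2 ∧
    ((Finset.Icc 1 N).filter (fun k => nodalS χ k = 2)).card + 1 ≤
      ((Finset.Icc 1 N).filter (fun k => nodalS χ k = 1)).card := by
  have hS1 : nodalS χ 1 = 1 := by
    have : ∀ i, χ i 1 = 1 := fun i => chi_one (h i) (by omega) (hp i)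
    simp [nodalS, this]
  refine ⟨hS1, ?_⟩
  -- two partitions bound the nodal sequence
  have two : ∀ k, 1 ≤ k → k ≤ N → ∀ a b : Fin n, a ≠ b →
      nodalS χ k ≤ χ a k + χ b k - k := by
    intro k h1 h2 a b hab
    rw [nodalS_eq]
    have hs : ∑ i ∈ ({a, b} : Finset (Fin n)), ((k : ℤ) - χ i k) ≤
        ∑ i, ((k : ℤ) - χ i k) := by
      apply Finset.sum_le_sum_of_subset_of_nonneg (Finset.subset_univ _)
      intro i _ _
      have := chi_le_self (h i) (hp i) h1 h2
      omega
    rw [Finset.sum_pair hab] at hs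
    linarith
  have stepnn : ∀ k, 1 ≤ k → k + 1 ≤ N → ∀ i, 0 ≤ (1 + (χ i k : ℤ) - χ i (k + 1)) := by
    intro k h1 h2 i
    have := chi_step (h i) h1 h2
    omega
  have step1 : ∀ k, 1 ≤ k → k + 1 ≤ N → ∀ i,
      nodalS χ (k + 1) ≤ nodalS χ k + χ i (k + 1) - χ i k := by
    intro k h1 h2 i
    rw [nodalS_step]
    have := Finset.single_le_sum (f := fun i => (1 + (χ i k : ℤ) - χ i (k + 1)))
      (fun j _ => stepnn k h1 h2 j) (Finset.mem_univ i)
    linarith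
  have notmost : ∀ k, (¬ ∃ i, ∀ j, j ≠ i → p j (χ j k) ≤ 1) →
      ∃ a b : Fin n, a ≠ b ∧ 2 ≤ p a (χ a k) ∧ 2 ≤ p b (χ b k) := by
    intro k hk
    push Not at hk
    obtain ⟨b, _, hb⟩ := hk ⟨0, by omega⟩
    obtain ⟨a, hab, ha⟩ := hk b
    exact ⟨a, b, hab, ha, hb⟩
  have early : ∀ k, 1 ≤ k → k ≤ N →
      ¬ (1 ≤ nodalS χ k ∧ ∃ i, ∀ j, j ≠ i → p j (χ j k) ≤ 1) →
      nodalS χ k ≤ 1 ∧ (k % 2 = 0 → nodalS χ k ≤ 0) := by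
    intro k h1 h2 hk
    by_cases hs : 1 ≤ nodalS χ k
    · obtain ⟨a, b, hab, ha, hb⟩ := notmost k (fun hh => hk ⟨hs, hh⟩)
      have := two k h1 h2 a b hab
      have := big_bound (h a) h1 h2 ha
      have := big_bound (h b) h1 h2 hb
      omega
    · omega
  by_cases hw : ∃ k, 1 ≤ k ∧ k ≤ N ∧ 1 ≤ nodalS χ k ∧ ∃ i, ∀ j, j ≠ i → p j (χ j k) ≤ 1
  swap
  · push Not at hw
    have hb : ∀ k, 1 ≤ k → k ≤ N → nodalS χ k ≤ 1 ∧ (k % 2 = 0 → nodalS χ k ≤ 0) := by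
      intro k h1 h2
      apply early k h1 h2
      rintro ⟨hs, i, hi⟩
      obtain ⟨j, hj, hj'⟩ := hw k h1 h2 hs i
      have := hi j hj
      omega
    refine ⟨(pair_count _ N hb).trans (by omega), ?_⟩
    have e : (Finset.Icc 1 N).filter (fun k => nodalS χ k = 2) = ∅ := by
      apply Finset.filter_eq_empty_iff.2
      intro k hk
      rw [Finset.mem_Icc] at hk
      have := hb k hk.1 hk.2
      omega
    rw [e]
    simp only [Finset.card_empty, zero_add]
    exact Finset.card_pos.2 ⟨1, by simp [hS1]; omega⟩
  classical
  obtain ⟨w, ⟨hw1, hwN, hwS, i, hi⟩, hmin⟩ : ∃ w, (1 ≤ w ∧ w ≤ N ∧ 1 ≤ nodalS χ w ∧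
      ∃ i, ∀ j, j ≠ i → p j (χ j w) ≤ 1) ∧ ∀ k, k < w → ¬ (1 ≤ k ∧ k ≤ N ∧ 1 ≤ nodalS χ k ∧
      ∃ i, ∀ j, j ≠ i → p j (χ j k) ≤ 1) :=
    ⟨Nat.find hw, Nat.find_spec hw, fun k hk => Nat.find_min hw hk⟩
  have hb : ∀ k, 1 ≤ k → k < w → nodalS χ k ≤ 1 ∧ (k % 2 = 0 → nodalS χ k ≤ 0) := by
    intro k h1 h2
    exact early k h1 (by omega) (fun hh => hmin k h2 ⟨h1, by omega, hh⟩)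
  -- `w` is not 1
  obtain ⟨v, rfl⟩ : ∃ v, w = v + 1 := ⟨w - 1, by omega⟩
  have hv : 1 ≤ v := by
    by_contra hv
    have hv : v = 0 := by omega
    subst hv
    obtain ⟨j, hj⟩ : ∃ j : Fin n, j ≠ i := by
      have : Nontrivial (Fin n) := Fin.nontrivial_iff_two_le.2 hn
      exact exists_ne i
    have h3 := hi j hj
    have h4 := hp j
    rw [zero_add, chi_one (h j) (by omega) (hp j)] at h3
    omega
  have hvS : nodalS χ v ≤ 0 := by
    by_contra hc
    have hm : ¬ ∃ i, ∀ j, j ≠ i → p j (χ j v) ≤ 1 := fun hh =>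
      hmin v (by omega) ⟨hv, by omega, by omega, hh⟩
    obtain ⟨a, b, hab, ha, hb'⟩ := notmost v hm
    have h0 := two v hv (by omega) a b hab
    have h1 := big_bound (h a) hv (by omega) ha
    have h2 := big_bound (h b) hv (by omega) hb'
    by_cases hai : a = i
    · have h3 := hi b (by rw [← hai]; exact hab.symm)
      have := big_end (h b) hv hwN hb' (fun e => by rw [e] at h3; omega)
      omega
    · have h3 := hi a hai
      have := big_end (h a) hv hwN ha (fun e => by rw [e] at h3; omega)
      omega
  have hst := step1 v hv hwN i
  have hci := chi_step (h i) hv hwN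
  have hcs : χ i (v + 1) = χ i v + 1 := by omega
  have hwS1 : nodalS χ (v + 1) = 1 := by omega
  set d := χ i v with hd
  have hds := chi_spec (h i) hv (by omega)
  rw [← hd] at hds
  have hvd : psum (p i) d = v := by
    have := chi_spec (h i) hw1 hwN
    rw [hcs, Nat.add_sub_cancel] at this
    omega
  -- after w
  have small : ∀ k, v + 1 ≤ k → k ≤ N → ∀ j, j ≠ i → p j (χ j k) ≤ 1 := by
    intro k hk
    induction k, hk using Nat.le_induction with
    | base => intro _; exact hi
    | succ k hk ih =>
      intro hkN j hj
      exact small_next (h j) (by omega) hkN (ih (by omega) j hj)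
  have late : ∀ k, v + 1 ≤ k → k ≤ N → nodalS χ k = χ i k - d := by
    intro k hk
    induction k, hk using Nat.le_induction with
    | base => intro _; rw [hwS1, hcs]; push_cast; ring
    | succ k hk ih =>
      intro hkN
      have h3 := ih (by omega)
      rw [nodalS_step, Finset.sum_eq_single i, h3]
      · ring
      · intro j _ hj
        rw [small_step (h j) (by omega) hkN (small k hk (by omega) j hj)]
        push_cast; ring
      · simp
  have e1 := psum_succ (p i) d
  have e2 := psum_succ (p i) (d + 1)
  have e0 := psum_succ (p i) (d - 1)
  rw [Nat.sub_add_cancel hds.1] at e0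
  have b1 := psum_le (h i).1 (d + 1)
  have b0 := part_anti (h i).1 hds.1 (show d ≤ d + 1 by omega)
  have b2 := part_anti (h i).1 (show 1 ≤ d + 1 by omega) (show d + 1 ≤ d + 1 + 1 by omega)
  refine count_main (nodalS χ) N (psum (p i) (d - 1) + 1) (v + 1) (p i (d + 1))
    (p i (d + 1 + 1)) (by omega) (by omega) (by omega) b2 (by omega) hS1 hb ?_ ?_ ?_
  · -- within a part of i, the sequence does not increase
    have hconst : ∀ k, psum (p i) (d - 1) + 1 ≤ k → k ≤ v → χ i k = d := by
      intro k h1 h2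
      have h3 := chi_le_iff (h i) (k := k) (by omega) (by omega) d
      have h4 := chi_le_iff (h i) (k := k) (by omega) (by omega) (d - 1)
      omega
    intro k hk
    have hk' : psum (p i) (d - 1) + 1 + 1 ≤ k := hk
    clear hk
    induction k, hk' using Nat.le_induction with
    | base =>
      intro hlt
      have h3 := step1 (psum (p i) (d - 1) + 1) (by omega) (by omega) i
      rw [hconst _ le_rfl (by omega), hconst _ (by omega) (by omega)] at h3
      have h4 := hb (psum (p i) (d - 1) + 1) (by omega) (by omega)
      have h5 := hb (psum (p i) (d - 1) + 1 + 1) (by omega) (by omega)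
      omega
    | succ k hk ih =>
      intro hlt
      have h3 := step1 k (by omega) (by omega) i
      rw [hconst k (by omega) (by omega), hconst (k + 1) (by omega) (by omega)] at h3
      have := ih (by omega)
      omega
  · intro k h1 h2
    rw [late k h1 h2]
    have h3 := chi_le_iff (h i) (k := k) (by omega) (by omega) d
    have h4 := chi_le_iff (h i) (k := k) (by omega) (by omega) (d + 1)
    omega
  · intro k h1 h2
    rw [late k h1 h2]
    have h3 := chi_le_iff (h i) (k := k) (by omega) (by omega) (d + 1)
    have h4 := chi_le_iff (h i) (k := k) (by omega) (by omega) (d + 1 + 1)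
    omega

/-- with `m₁`, `m₂` the multiplicities of `1`, `2` in the nodal sequence and
`b^C` the number of center parameters, we have `m₁ − 2 ≤ 2·b^C ≤ 2·(m₁ − m₂ − 1)`. -/
theorem center_parameter_count_bounds
    (N n : ℕ) (hN : 2 ≤ N) (hn : 2 ≤ n)
    (p χ : Fin n → ℕ → ℕ)
    (h : ∀ i, IsVanishingOrderSeq N (p i) (χ i) ∧ 2 ≤ p i 1) :
    ((((Finset.Icc 1 N).filter
        (fun k => max 1 ((∑ i, (χ i k : ℤ)) - ((n : ℤ) - 1) * (k : ℤ)) = 1)).card : ℤ) - 2 ≤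
       2 * (((Finset.Icc 2 N).filter (fun k => (∑ i, χ i k) ≤ (n - 1) * k)).card : ℤ)) ∧
    (2 * (((Finset.Icc 2 N).filter (fun k => (∑ i, χ i k) ≤ (n - 1) * k)).card : ℤ) ≤
       2 * (((((Finset.Icc 1 N).filter
            (fun k => max 1 ((∑ i, (χ i k : ℤ)) - ((n : ℤ) - 1) * (k : ℤ)) = 1)).card : ℤ) -
          ((((Finset.Icc 1 N).filter
            (fun k => max 1 ((∑ i, (χ i k : ℤ)) - ((n : ℤ) - 1) * (k : ℤ)) = 2)).card : ℤ)) - 1))) := by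
  obtain ⟨hS1, hA, hB⟩ := core hN hn p χ (fun i => (h i).1) (fun i => (h i).2)
  have f1 : (Finset.Icc 1 N).filter
        (fun k => max 1 ((∑ i, (χ i k : ℤ)) - ((n : ℤ) - 1) * (k : ℤ)) = 1) =
      (Finset.Icc 1 N).filter (fun k => nodalS χ k = 1) ∪
        (Finset.Icc 1 N).filter (fun k => nodalS χ k ≤ 0) := by
    rw [← Finset.filter_or]
    apply Finset.filter_congr
    intro k _
    change max 1 (nodalS χ k) = 1 ↔ _
    omega
  have f2 : (Finset.Icc 1 N).filter
        (fun k => max 1 ((∑ i, (χ i k : ℤ)) - ((n : ℤ) - 1) * (k : ℤ)) = 2) =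
      (Finset.Icc 1 N).filter (fun k => nodalS χ k = 2) := by
    apply Finset.filter_congr
    intro k _
    change max 1 (nodalS χ k) = 2 ↔ _
    omega
  have f3 : (Finset.Icc 2 N).filter (fun k => (∑ i, χ i k) ≤ (n - 1) * k) =
      (Finset.Icc 1 N).filter (fun k => nodalS χ k ≤ 0) := by
    ext k
    simp only [Finset.mem_filter, Finset.mem_Icc]
    have key : (∑ i, χ i k) ≤ (n - 1) * k ↔ nodalS χ k ≤ 0 := by
      unfold nodalS
      rw [← Nat.cast_le (α := ℤ)]
      push_cast [Nat.cast_sub (show 1 ≤ n by omega)]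
      exact sub_nonpos.symm
    rw [key]
    constructor
    · rintro ⟨a, b⟩; exact ⟨by omega, b⟩
    · rintro ⟨a, b⟩
      refine ⟨⟨?_, a.2⟩, b⟩
      by_contra hk
      have hk : k = 1 := by omega
      subst hk
      omega
  have hd : Disjoint ((Finset.Icc 1 N).filter (fun k => nodalS χ k = 1))
      ((Finset.Icc 1 N).filter (fun k => nodalS χ k ≤ 0)) := by
    rw [Finset.disjoint_left]
    intro k hk hk'
    simp only [Finset.mem_filter] at hk hk'
    omega
  rw [f1, f2, f3, Finset.card_union_of_disjoint hd]
  push_cast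
  omega
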